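/- For every ε > 0 there exists a finite constant C such that for all integers h ≥ 1 and k ≥ 0, if the chain Z starts at k then P(τ̃_h < ∞ and Z̃_{τ̃_h} = h) < C·h^{−1/2+ε}. -/

import Mathlib

open MeasureTheory ProbabilityTheory
open scoped ENNReal

/-- ρ(i,j) := 2^{−i−j−1}·(i+j)!/(i!·j!). -/
noncomputable def rho (i j : ℕ) : ℝ :=
  (2 : ℝ) ^ (-(i : ℝ) - (j : ℝ) - 1) * (Nat.factorial (i + j)) /
    ((Nat.factorial i) * (Nat.factorial j))

/-- `Z` is a Markov chain with transition probabilities `trans` started at `k`: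
`P(Z_0 = k) = 1` and
`P(Z_0 = k_0, …, Z_n = k_n) = P(Z_0 = k_0) · ∏_{0 ≤ i < n} trans(k_i, k_{i+1})`. -/
def IsMarkovChainFrom {Ω : Type*} [MeasurableSpace Ω] (P : Measure Ω)
    (Z : ℕ → Ω → ℕ) (trans : ℕ → ℕ → ℝ) (k : ℕ) : Prop :=
  (∀ t, Measurable (Z t)) ∧
    ∀ (n : ℕ) (ks : ℕ → ℕ),
      P {ω | ∀ i ≤ n, Z i ω = ks i} =
        ENNReal.ofReal ((if ks 0 = k then 1 else 0) *
          ∏ i ∈ Finset.range n, trans (ks i) (ks (i + 1)))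


/-- `Z̃_t := Z_t + Z_{t−1} + 1`. -/
def Ztil {Ω : Type*} (Z : ℕ → Ω → ℕ) (t : ℕ) (ω : Ω) : ℕ :=
  Z t ω + Z (t - 1) ω + 1

/-- `τ̃_h := inf{t ≥ 1 : Z̃_t ≥ h}` (with value `∞` if there is no such `t`). -/
noncomputable def tauTil {Ω : Type*} (Z : ℕ → Ω → ℕ) (h : ℕ) (ω : Ω) : ℕ∞ :=
  sInf ((↑) '' {t : ℕ | 1 ≤ t ∧ h ≤ Ztil Z t ω} : Set ℕ∞)


lemma rho_eq (i j : ℕ) : rho i j = ((i + j).choose j : ℝ) / 2 ^ (i + j + 1) := by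
  have h1 : (2 : ℝ) ^ (-(i : ℝ) - (j : ℝ) - 1) = ((2 : ℝ) ^ (i + j + 1))⁻¹ := by
    rw [← Real.rpow_natCast, ← Real.rpow_neg (by norm_num)]
    congr 1
    push_cast
    ring
  have h2 : (((i + j).choose j : ℕ) : ℝ) * i.factorial * j.factorial = (i + j).factorial := by
    exact_mod_cast Nat.add_choose_mul_factorial_mul_factorial i j
  rw [rho, h1, ← h2]
  field_simp

lemma rho_nonneg (i j : ℕ) : 0 ≤ rho i j := by
  rw [rho_eq]
  positivity

lemma succ_mul_rho_succ (i j : ℕ) :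
    2 * ((j + 1 : ℕ) * rho i (j + 1)) = (i + j + 1) * rho i j := by
  have h : ((i + j + 1 : ℕ) : ℝ) * (i + j).choose j = (i + j + 1).choose (j + 1) * (j + 1 : ℕ) := by
    exact_mod_cast Nat.add_one_mul_choose_eq (i + j) j
  rw [rho_eq, rho_eq, ← add_assoc, pow_succ _ (i + j + 1)]
  push_cast at h ⊢
  field_simp
  linarith

/-- Truncated first moment of `rho i`, centred at its mean `i + 1`. -/
lemma sum_rho_mul_mean_sub (i n : ℕ) :
    ∑ j ∈ Finset.range n, rho i j * (i + 1 - j) = 2 * (n * rho i n) := by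
  induction n with
  | zero => simp
  | succ n ih =>
    rw [Finset.sum_range_succ, ih, succ_mul_rho_succ]
    ring

/-- The probability `P(Bin(m, 1/2) ≤ i)`. -/
noncomputable def binomCdf (m i : ℕ) : ℝ :=
  (∑ l ∈ Finset.range (i + 1), (m.choose l : ℝ)) / 2 ^ m

lemma binomCdf_succ (m i : ℕ) :
    binomCdf (m + 1) i = binomCdf m i - (m.choose i : ℝ) / 2 ^ (m + 1) := by
  have h : ∑ l ∈ Finset.range (i + 1), ((m + 1).choose l : ℝ) =
      2 * ∑ l ∈ Finset.range (i + 1), (m.choose l : ℝ) - m.choose i := by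
    induction i with
    | zero => simp; norm_num
    | succ i ih =>
      rw [Finset.sum_range_succ, ih, Finset.sum_range_succ _ (i + 1), Nat.choose_succ_succ]
      push_cast
      ring
  rw [binomCdf, binomCdf, h, pow_succ]
  field_simp

/-- Waiting for `i + 1` heads takes more than `i + n` flips exactly when the first `i + n` flips
contain at most `i` heads. -/
lemma sum_rho_eq (i n : ℕ) :
    ∑ j ∈ Finset.range n, rho i j = 1 - binomCdf (i + n) i := by
  induction n with
  | zero =>
    have h := Nat.sum_range_choose i
    have h' : ∑ l ∈ Finset.range (i + 1), (i.choose l : ℝ) = 2 ^ i := by exact_mod_cast h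
    simp [binomCdf, h']
  | succ n ih =>
    rw [Finset.sum_range_succ, ih, ← add_assoc, binomCdf_succ, rho_eq, Nat.choose_symm_add]
    ring

lemma choose_div_le_binomCdf (m i : ℕ) : (m.choose i : ℝ) / 2 ^ m ≤ binomCdf m i := by
  unfold binomCdf
  gcongr
  exact Finset.single_le_sum (f := fun l => (m.choose l : ℝ)) (fun _ _ => by positivity)
    (Finset.self_mem_range_succ i)

/-- A function `D + E (h - i)` is superharmonic for the killed chain once `D` and `E` control the
one-step probability of hitting the level exactly. -/
lemma rho_add_sum_le {D E : ℝ} (hE : 0 ≤ E) (i n : ℕ)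
    (h : rho i n ≤ D * binomCdf (i + n) i + E) :
    rho i n + ∑ j ∈ Finset.range n, rho i j * (D + E * (i + n + 1 - j)) ≤ D + E * (n + 1) := by
  have h1 : ∑ j ∈ Finset.range n, rho i j * (D + E * (i + n + 1 - j)) =
      (D + E * n) * ∑ j ∈ Finset.range n, rho i j +
        E * ∑ j ∈ Finset.range n, rho i j * (i + 1 - j) := by
    rw [Finset.mul_sum, Finset.mul_sum, ← Finset.sum_add_distrib]
    exact Finset.sum_congr rfl fun j _ => by ring
  have h2 : 2 * rho i n ≤ binomCdf (i + n) i := by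
    convert choose_div_le_binomCdf (i + n) i using 1
    rw [rho_eq, Nat.choose_symm_add, pow_succ]
    field_simp
  rw [h1, sum_rho_eq, sum_rho_mul_mean_sub]
  nlinarith [mul_le_mul_of_nonneg_left h2 (mul_nonneg hE n.cast_nonneg)]

lemma choose_sub_lower {m j L : ℕ} (hj : 2 * j ≤ m)
    (hL : 4 * (L : ℝ) * (m - 2 * j + 2 * L) ≤ m) (s : ℕ) (hs : s ≤ L) :
    s ≤ j ∧ (m.choose j : ℝ) * (1 - s * (2 * (m - 2 * j + 2 * L) / m)) ≤ m.choose (j - s) := by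
  induction s with
  | zero => simp
  | succ s ih =>
    obtain ⟨hsj, ih⟩ := ih (by omega)
    set x : ℝ := 2 * (m - 2 * j + 2 * L) / m with hx
    have hj' : 2 * (j : ℝ) ≤ m := by exact_mod_cast hj
    have hsL : (s : ℝ) + 1 ≤ L := by exact_mod_cast hs
    have hs0 : (0 : ℝ) ≤ s := s.cast_nonneg
    have hL1 : 4 * (m - 2 * j + 2 * (L : ℝ)) ≤ m := by nlinarith
    have hjL : (L : ℝ) < j := by linarith
    have hjL' : L < j := by exact_mod_cast hjL
    have hm : (0 : ℝ) < m := by linarith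
    have hxm : x * m = 2 * (m - 2 * j + 2 * L) := by rw [hx]; field_simp
    have hx0 : 0 ≤ x := by
      rw [hx]
      exact div_nonneg (by linarith) hm.le
    have hx1 : x ≤ 1 := by
      rw [hx, div_le_one hm]
      linarith
    refine ⟨by omega, ?_⟩
    have hrec : (m.choose (j - s) : ℝ) * (j - s) = m.choose (j - (s + 1)) * (m - j + s + 1) := by
      have h := Nat.choose_succ_right_eq m (j - (s + 1))
      rw [show j - (s + 1) + 1 = j - s by omega] at h
      have h' : ((m.choose (j - s) * (j - s) : ℕ) : ℝ) =
        (m.choose (j - (s + 1)) * (m - (j - (s + 1))) : ℕ) := by rw [h]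
      rw [Nat.cast_mul, Nat.cast_mul, Nat.cast_sub hsj, Nat.cast_sub (by omega),
        Nat.cast_sub (by omega)] at h'
      rw [h']
      push_cast
      ring
    have hd : (0 : ℝ) < m - j + s + 1 := by linarith
    have hstep : (m.choose (j - s) : ℝ) * (1 - x) ≤ m.choose (j - (s + 1)) := by
      refine le_of_mul_le_mul_right ?_ hd
      rw [← hrec, mul_assoc]
      refine mul_le_mul_of_nonneg_left ?_ (Nat.cast_nonneg _)
      nlinarith
    have hC : (0 : ℝ) ≤ m.choose j := Nat.cast_nonneg _
    have h1 := mul_le_mul_of_nonneg_right ih (sub_nonneg.2 hx1)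
    have h2 : 0 ≤ (m.choose j : ℝ) * (s * x * x) := by positivity
    push_cast
    linarith

/-- Near the middle, the hazard rate of the binomial distribution is small. -/
lemma succ_mul_choose_le {m j L : ℕ} (hj : 2 * j ≤ m)
    (hL : 4 * (L : ℝ) * (m - 2 * j + 2 * L) ≤ m) :
    ((L : ℝ) + 1) * m.choose j ≤ 2 * ∑ l ∈ Finset.range (j + 1), (m.choose l : ℝ) := by
  have hLj : L ≤ j := (choose_sub_lower hj hL L le_rfl).1
  have hj' : 2 * (j : ℝ) ≤ m := by exact_mod_cast hj
  have hhalf : ∀ s ∈ Finset.range (L + 1), (m.choose j : ℝ) / 2 ≤ m.choose (j - s) := by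
    intro s hs
    have hs : s ≤ L := Nat.lt_succ_iff.1 (Finset.mem_range.1 hs)
    refine le_trans ?_ (choose_sub_lower hj hL s hs).2
    rw [div_eq_mul_inv]
    refine mul_le_mul_of_nonneg_left ?_ (Nat.cast_nonneg _)
    have hsL : (s : ℝ) ≤ L := by exact_mod_cast hs
    have hx : (s : ℝ) * (2 * (m - 2 * j + 2 * L) / m) ≤ 1 / 2 := by
      rw [← mul_div_assoc]
      refine div_le_of_le_mul₀ m.cast_nonneg (by norm_num) ?_
      nlinarith [(s.cast_nonneg : (0 : ℝ) ≤ s)]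
    linarith
  have h1 := Finset.card_nsmul_le_sum _ _ _ hhalf
  have h2 : ∑ s ∈ Finset.range (L + 1), (m.choose (j - s) : ℝ) ≤
      ∑ s ∈ Finset.range (j + 1), (m.choose (j - s) : ℝ) :=
    Finset.sum_le_sum_of_subset_of_nonneg (Finset.range_mono (by omega))
      fun _ _ _ => Nat.cast_nonneg _
  have h3 := Finset.sum_range_reflect (fun l => (m.choose l : ℝ)) (j + 1)
  simp only [Nat.add_sub_cancel] at h3
  rw [Finset.card_range, nsmul_eq_mul] at h1
  push_cast at h1
  linarith

lemma choose_div_le_exp {m : ℕ} (hm : 0 < m) (j : ℕ) :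
    (m.choose j : ℝ) / 2 ^ m ≤ Real.exp (-(((m : ℝ) - 2 * j) ^ 2 / (2 * m))) := by
  rcases lt_or_ge m j with hmj | hjm
  · simp only [Nat.choose_eq_zero_of_lt hmj, Nat.cast_zero, zero_div]
    positivity
  have hm' : (0 : ℝ) < m := by exact_mod_cast hm
  set c : ℝ := ((m : ℝ) - 2 * j) / m with hc
  have hterm : Real.exp (-c) ^ j * Real.exp c ^ (m - j) * m.choose j ≤
      (Real.exp (-c) + Real.exp c) ^ m := by
    rw [add_pow]
    exact Finset.single_le_sum
      (f := fun l => Real.exp (-c) ^ l * Real.exp c ^ (m - l) * (m.choose l : ℝ))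
      (fun _ _ => by positivity) (Finset.mem_range.2 (by omega))
  have hcosh : (Real.exp (-c) + Real.exp c) ^ m ≤ 2 ^ m * Real.exp (m * (c ^ 2 / 2)) := by
    have h1 : Real.exp (-c) + Real.exp c = 2 * Real.cosh c := by
      rw [Real.cosh_eq]
      ring
    rw [h1, mul_pow, Real.exp_nat_mul]
    gcongr
    exact Real.cosh_le_exp_half_sq c
  have hexp : Real.exp (-c) ^ j * Real.exp c ^ (m - j) = Real.exp (m * c ^ 2) := by
    rw [← Real.exp_nat_mul, ← Real.exp_nat_mul, ← Real.exp_add, Nat.cast_sub hjm]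
    congr 1
    have : (m : ℝ) * c = m - 2 * j := by
      rw [hc]
      field_simp
    linear_combination (-c) * this
  rw [div_le_iff₀ (by positivity)]
  have hgoal : Real.exp (m * c ^ 2) * m.choose j ≤
      Real.exp (m * c ^ 2) * (Real.exp (-(((m : ℝ) - 2 * j) ^ 2 / (2 * m))) * 2 ^ m) := by
    rw [hexp] at hterm
    refine (hterm.trans hcosh).trans_eq ?_
    rw [← mul_assoc, ← Real.exp_add, mul_comm]
    congr 2
    rw [hc]
    field_simp
    ring
  exact le_of_mul_le_mul_left hgoal (Real.exp_pos _)

lemma exists_exp_neg_rpow_le {a : ℝ} (ha : 0 < a) :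
    ∃ K : ℝ, 0 ≤ K ∧ ∀ x : ℝ, 1 ≤ x → Real.exp (-(x ^ a / 2)) ≤ K / x ^ 2 := by
  obtain ⟨N, hN⟩ := exists_nat_ge (2 / a)
  refine ⟨N.factorial * 2 ^ N, by positivity, fun x hx => ?_⟩
  have hx0 : 0 < x := by linarith
  have h1 := Real.pow_div_factorial_le_exp (x ^ a / 2) (by positivity) N
  have h2 : x ^ 2 ≤ (x ^ a) ^ N := by
    rw [← Real.rpow_natCast (x ^ a), ← Real.rpow_mul hx0.le, ← Real.rpow_natCast x 2]
    refine Real.rpow_le_rpow_of_exponent_le hx ?_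
    rw [div_le_iff₀ ha] at hN
    push_cast
    linarith
  rw [Real.exp_neg, inv_le_comm₀ (Real.exp_pos _) (by positivity), inv_div]
  refine le_trans ?_ h1
  rw [div_pow, div_div, mul_comm ((N.factorial : ℝ))]
  gcongr

lemma binomCdf_mono (m : ℕ) : Monotone (binomCdf m) := by
  intro i j hij
  unfold binomCdf
  gcongr

lemma binomCdf_nonneg (m i : ℕ) : 0 ≤ binomCdf m i := by
  unfold binomCdf
  positivity

lemma lt_of_tauTil_eq {Ω : Type*} {Z : ℕ → Ω → ℕ} {h t : ℕ} {ω : Ω} (ht : tauTil Z h ω = t) :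
    1 ≤ t ∧ ∀ s, 1 ≤ s → s < t → Ztil Z s ω < h := by
  set S : Set ℕ∞ := (↑) '' {t : ℕ | 1 ≤ t ∧ h ≤ Ztil Z t ω}
  have ht : sInf S = t := ht
  constructor
  · have : (1 : ℕ∞) ≤ sInf S := le_sInf (by
      rintro _ ⟨s, hs, rfl⟩
      exact_mod_cast hs.1)
    rw [ht] at this
    exact_mod_cast this
  · intro s hs hst
    by_contra! hc
    have : sInf S ≤ s := sInf_le ⟨s, ⟨hs, hc⟩, rfl⟩
    rw [ht] at this
    have : t ≤ s := by exact_mod_cast this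
    omega

section MarkovChain

variable {Ω : Type*} [MeasurableSpace Ω] {P : Measure Ω} {Z : ℕ → Ω → ℕ} {trans : ℕ → ℕ → ℝ}
  {k h : ℕ}

lemma IsMarkovChainFrom.measure_cylinder_update (hZ : IsMarkovChainFrom P Z trans k)
    (htrans : ∀ i j, 0 ≤ trans i j) (n : ℕ) (ks : ℕ → ℕ) (j : ℕ) :
    P {ω | ∀ i ≤ n + 1, Z i ω = Function.update ks (n + 1) j i} =
      P {ω | ∀ i ≤ n, Z i ω = ks i} * ENNReal.ofReal (trans (ks n) j) := by
  have h0 : Function.update ks (n + 1) j 0 = ks 0 := by simp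
  have hprod : ∏ i ∈ Finset.range n,
      trans (Function.update ks (n + 1) j i) (Function.update ks (n + 1) j (i + 1)) =
      ∏ i ∈ Finset.range n, trans (ks i) (ks (i + 1)) := by
    refine Finset.prod_congr rfl fun i hi => ?_
    have hi := Finset.mem_range.1 hi
    rw [Function.update_of_ne (by omega), Function.update_of_ne (by omega)]
  rw [hZ.2, hZ.2, Finset.prod_range_succ, hprod, h0, Function.update_self,
    Function.update_of_ne (by omega), ← mul_assoc, ENNReal.ofReal_mul]
  exact mul_nonneg (by split_ifs <;> simp) (Finset.prod_nonneg fun _ _ => htrans _ _)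

/-- Superharmonic functions bound the probability that the first passage of `Ztil Z` over `h` after
time `n` occurs within `N` steps and hits `h` exactly. -/
lemma IsMarkovChainFrom.measure_hit_within_le (hZ : IsMarkovChainFrom P Z trans k)
    (htrans : ∀ i j, 0 ≤ trans i j) {F : ℕ → ℝ≥0∞}
    (hF : ∀ i n, i + n + 1 = h → ENNReal.ofReal (trans i n) +
      ∑ j ∈ Finset.range n, ENNReal.ofReal (trans i j) * F j ≤ F i) (N : ℕ) :
    ∀ (n : ℕ) (ks : ℕ → ℕ),
      P {ω | (∀ i ≤ n, Z i ω = ks i) ∧ ∃ t, n < t ∧ t ≤ n + N ∧ Ztil Z t ω = h ∧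
        ∀ s, n < s → s < t → Ztil Z s ω < h} ≤ P {ω | ∀ i ≤ n, Z i ω = ks i} * F (ks n) := by
  induction N with
  | zero =>
    intro n ks
    refine (measure_mono_null ?_ (measure_empty (μ := P))).trans_le zero_le
    rintro ω ⟨-, t, h1, h2, -⟩
    omega
  | succ N ih =>
    intro n ks
    set A := {ω | (∀ i ≤ n, Z i ω = ks i) ∧ ∃ t, n < t ∧ t ≤ n + (N + 1) ∧ Ztil Z t ω = h ∧
        ∀ s, n < s → s < t → Ztil Z s ω < h}
    have hnext (ω) (hω : ∀ i ≤ n, Z i ω = ks i) :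
        Ztil Z (n + 1) ω = ks n + Z (n + 1) ω + 1 := by
      rw [Ztil, Nat.add_sub_cancel, hω n le_rfl, add_comm (ks n)]
    have hcyl (ω) (hω : ∀ i ≤ n, Z i ω = ks i) :
        ∀ i ≤ n + 1, Z i ω = Function.update ks (n + 1) (Z (n + 1) ω) i := by
      intro i hi
      rcases Nat.lt_or_eq_of_le hi with hi | rfl
      · rw [Function.update_of_ne (by omega), hω i (by omega)]
      · simp
    by_cases hlt : ks n < h
    · obtain ⟨m, hm⟩ : ∃ m, ks n + m + 1 = h := ⟨h - ks n - 1, by omega⟩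
      set B : ℕ → Set Ω := fun j => {ω | (∀ i ≤ n + 1, Z i ω = Function.update ks (n + 1) j i) ∧
        ∃ t, n + 1 < t ∧ t ≤ n + 1 + N ∧ Ztil Z t ω = h ∧ ∀ s, n + 1 < s → s < t → Ztil Z s ω < h}
      have hsub : A ⊆ {ω | ∀ i ≤ n + 1, Z i ω = Function.update ks (n + 1) m i} ∪
          ⋃ j ∈ Finset.range m, B j := by
        rintro ω ⟨hω, t, ht1, ht2, ht3, ht4⟩
        have hn := hnext ω hω
        rcases Nat.lt_or_eq_of_le (Nat.succ_le_of_lt ht1) with ht | rfl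
        · right
          have := ht4 (n + 1) (by omega) ht
          simp only [Set.mem_iUnion, Finset.mem_range]
          exact ⟨Z (n + 1) ω, by omega, hcyl ω hω, t, ht, by omega, ht3,
            fun s hs hs' => ht4 s (by omega) hs'⟩
        · left
          have hm' : m = Z (n + 1) ω := by
            simp only [Nat.succ_eq_add_one] at ht3
            omega
          simpa only [Set.mem_ofPred_eq, hm'] using hcyl ω hω
      calc P A ≤ P {ω | ∀ i ≤ n + 1, Z i ω = Function.update ks (n + 1) m i} +
            ∑ j ∈ Finset.range m, P (B j) :=
            (measure_mono hsub).trans ((measure_union_le _ _).trans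
              (add_le_add le_rfl (measure_biUnion_finset_le _ _)))
        _ ≤ P {ω | ∀ i ≤ n, Z i ω = ks i} * ENNReal.ofReal (trans (ks n) m) +
            ∑ j ∈ Finset.range m, P {ω | ∀ i ≤ n, Z i ω = ks i} *
              (ENNReal.ofReal (trans (ks n) j) * F j) := by
            rw [hZ.measure_cylinder_update htrans]
            refine add_le_add le_rfl (Finset.sum_le_sum fun j _ => ?_)
            refine (ih (n + 1) (Function.update ks (n + 1) j)).trans_eq ?_
            rw [hZ.measure_cylinder_update htrans, Function.update_self, mul_assoc]
        _ ≤ _ := by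
            rw [← Finset.mul_sum, ← mul_add]
            exact mul_le_mul_right (hF _ _ hm) _
    · have hA : A = ∅ := by
        ext ω
        simp only [A, Set.mem_ofPred_eq, Set.mem_empty_iff_false, iff_false]
        rintro ⟨hω, t, ht1, -, ht3, ht4⟩
        have hn := hnext ω hω
        rcases Nat.lt_or_eq_of_le (Nat.succ_le_of_lt ht1) with ht | rfl
        · have := ht4 (n + 1) (by omega) ht
          omega
        · simp only [Nat.succ_eq_add_one] at ht3
          omega
      rw [hA, measure_empty]
      exact zero_le

lemma IsMarkovChainFrom.measure_hit_le [IsProbabilityMeasure P]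
    (hZ : IsMarkovChainFrom P Z trans k) (htrans : ∀ i j, 0 ≤ trans i j) {F : ℕ → ℝ≥0∞}
    (hF : ∀ i n, i + n + 1 = h → ENNReal.ofReal (trans i n) +
      ∑ j ∈ Finset.range n, ENNReal.ofReal (trans i j) * F j ≤ F i) :
    P {ω | ∃ t : ℕ, tauTil Z h ω = (t : ℕ∞) ∧ Ztil Z t ω = h} ≤ F k := by
  set A : ℕ → Set Ω := fun N => {ω | (∀ i ≤ 0, Z i ω = k) ∧ ∃ t, 0 < t ∧ t ≤ 0 + N ∧
    Ztil Z t ω = h ∧ ∀ s, 0 < s → s < t → Ztil Z s ω < h}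
  have hstart : P {ω | ∀ i ≤ 0, Z i ω = k} = 1 := by
    simpa using hZ.2 0 fun _ => k
  have hA (N : ℕ) : P (A N) ≤ F k := by
    have := hZ.measure_hit_within_le htrans hF N 0 fun _ => k
    rwa [hstart, one_mul] at this
  have hmono : Monotone A := by
    rintro N N' hN ω ⟨h0, t, h1, h2, h3⟩
    exact ⟨h0, t, h1, by omega, h3⟩
  have hnull : P {ω | ∀ i ≤ 0, Z i ω = k}ᶜ = 0 := by
    rw [prob_compl_eq_zero_iff₀ ?_, hstart]
    have : {ω | ∀ i ≤ 0, Z i ω = k} = Z 0 ⁻¹' {k} := by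
      ext ω
      simp
    rw [this]
    exact (hZ.1 0 (measurableSet_singleton k)).nullMeasurableSet
  have hsub : {ω | ∃ t : ℕ, tauTil Z h ω = (t : ℕ∞) ∧ Ztil Z t ω = h} ⊆
      (⋃ N, A N) ∪ {ω | ∀ i ≤ 0, Z i ω = k}ᶜ := by
    rintro ω ⟨t, ht, hth⟩
    by_cases h0 : ∀ i ≤ 0, Z i ω = k
    · obtain ⟨h1, h2⟩ := lt_of_tauTil_eq ht
      exact Or.inl (Set.mem_iUnion.2 ⟨t, h0, t, h1, by omega, hth, h2⟩)
    · exact Or.inr h0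
  calc _ ≤ P (⋃ N, A N) + P {ω | ∀ i ≤ 0, Z i ω = k}ᶜ :=
        (measure_mono hsub).trans (measure_union_le _ _)
    _ = ⨆ N, P (A N) := by rw [hnull, add_zero, hmono.measure_iUnion]
    _ ≤ F k := iSup_le hA

end MarkovChain

lemma choose_div_le_of_near_middle {ε : ℝ} (hε : 0 < ε) (hε' : ε ≤ 1 / 4) {m j : ℕ}
    (hj : 2 * j ≤ m) (hjm : (m : ℝ) - 2 * j ≤ ((m + 1 : ℕ) : ℝ) ^ (1 / 2 + ε)) :
    (m.choose j : ℝ) / 2 ^ m ≤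
      32 * ((m + 1 : ℕ) : ℝ) ^ (-(1 : ℝ) / 2 + ε) * binomCdf m j := by
  have hj' : 2 * (j : ℝ) ≤ m := by exact_mod_cast hj
  set x : ℝ := ((m + 1 : ℕ) : ℝ) with hx
  have hxm : x = m + 1 := by simp [hx]
  have hx1 : 1 ≤ x := by
    rw [hxm]
    linarith [(m.cast_nonneg : (0 : ℝ) ≤ m)]
  have hx0 : 0 < x := by linarith
  set A : ℝ := x ^ (1 / 2 - ε)
  set T : ℝ := x ^ (1 / 2 + ε)
  set B : ℝ := x ^ (-(1 : ℝ) / 2 + ε)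
  have hA0 : 0 < A := by positivity
  have hAT : A * T = x := by
    rw [← Real.rpow_add hx0, show (1 / 2 - ε + (1 / 2 + ε) : ℝ) = 1 by ring, Real.rpow_one]
  have hAB : A * B = 1 := by
    rw [← Real.rpow_add hx0, show (1 / 2 - ε + (-(1 : ℝ) / 2 + ε) : ℝ) = 0 by ring,
      Real.rpow_zero]
  have hAleT : A ≤ T := Real.rpow_le_rpow_of_exponent_le hx1 (by linarith)
  set L : ℕ := ⌊A / 16⌋₊
  have hLle : (L : ℝ) ≤ A / 16 := Nat.floor_le (by positivity)
  have hltL : A / 16 < (L : ℝ) + 1 := Nat.lt_floor_add_one _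
  have hL0 : (0 : ℝ) ≤ L := L.cast_nonneg
  have hL : 4 * (L : ℝ) * (m - 2 * j + 2 * L) ≤ m := by
    rcases Nat.eq_zero_or_pos L with h0 | h1
    · simp [h0]
    · have h1 : (1 : ℝ) ≤ L := by exact_mod_cast h1
      have h2 : 4 * (L : ℝ) * (m - 2 * j + 2 * L) ≤ 4 * (A / 16) * (T + 2 * (T / 16)) := by
        gcongr
        linarith
      have h3 : (2 : ℝ) ≤ x := by nlinarith
      nlinarith
  have hmain := succ_mul_choose_le hj hL
  set S : ℝ := ∑ l ∈ Finset.range (j + 1), (m.choose l : ℝ) with hS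
  have hC : (0 : ℝ) ≤ m.choose j := Nat.cast_nonneg _
  have hB0 : 0 < B := by positivity
  have h1 : A / 16 * m.choose j ≤ 2 * S := by nlinarith
  have h2 : (m.choose j : ℝ) ≤ 32 * B * S := by
    have h := mul_le_mul_of_nonneg_left h1 hB0.le
    have h' : B * (A / 16 * m.choose j) = (m.choose j : ℝ) / 16 := by
      linear_combination (m.choose j : ℝ) / 16 * hAB
    linarith
  rw [binomCdf, ← hS, ← mul_div_assoc]
  gcongr

/-- The one-step probability of hitting `i + n + 1` exactly is small compared with the one-step
probability of reaching that level, up to a negligible error. -/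
lemma exists_rho_le {ε : ℝ} (hε : 0 < ε) (hε' : ε ≤ 1 / 4) :
    ∃ K : ℝ, 0 ≤ K ∧ ∀ h i n : ℕ, i + n + 1 = h →
      rho i n ≤ 16 * (h : ℝ) ^ (-(1 : ℝ) / 2 + ε) * binomCdf (i + n) i + K / h ^ 2 := by
  obtain ⟨K, hK0, hK⟩ := exists_exp_neg_rpow_le (a := 2 * ε) (by positivity)
  refine ⟨K, hK0, ?_⟩
  rintro _ i n rfl
  have hrho : rho i n = ((i + n).choose i : ℝ) / 2 ^ (i + n) / 2 := by
    rw [rho_eq, Nat.choose_symm_add, pow_succ]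
    field_simp
  rw [hrho]
  generalize i + n = m
  have hx1 : (1 : ℝ) ≤ ((m + 1 : ℕ) : ℝ) := by simp
  have hKx : 0 ≤ K / ((m + 1 : ℕ) : ℝ) ^ 2 := by positivity
  have hB0 : 0 ≤ ((m + 1 : ℕ) : ℝ) ^ (-(1 : ℝ) / 2 + ε) := by positivity
  have hT1 : 1 ≤ ((m + 1 : ℕ) : ℝ) ^ (1 / 2 + ε) := Real.one_le_rpow hx1 (by positivity)
  rcases le_or_gt (2 * i) m with hi | hi
  · rcases le_or_gt ((m : ℝ) - 2 * i) (((m + 1 : ℕ) : ℝ) ^ (1 / 2 + ε)) with hmid | htail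
    · linarith [choose_div_le_of_near_middle hε hε' hi hmid]
    · have hq := mul_nonneg hB0 (binomCdf_nonneg m i)
      have hm : 0 < m := by
        by_contra! hm
        have hm : m = 0 := by omega
        subst hm
        simp only [Nat.cast_zero] at htail
        linarith [(i.cast_nonneg : (0 : ℝ) ≤ i)]
      have hexp : Real.exp (-(((m : ℝ) - 2 * i) ^ 2 / (2 * m))) ≤
          Real.exp (-(((m + 1 : ℕ) : ℝ) ^ (2 * ε) / 2)) := by
        refine Real.exp_le_exp.2 (neg_le_neg ?_)
        have hm' : (0 : ℝ) < m := by exact_mod_cast hm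
        have hsq : (((m + 1 : ℕ) : ℝ) ^ (1 / 2 + ε)) ^ 2 =
            ((m + 1 : ℕ) : ℝ) * ((m + 1 : ℕ) : ℝ) ^ (2 * ε) := by
          rw [← Real.rpow_natCast, ← Real.rpow_mul (by positivity),
            ← Real.rpow_one_add' (by positivity) (by positivity)]
          congr 1
          push_cast
          ring
        have hsq' := pow_le_pow_left₀ (by positivity) htail.le 2
        rw [hsq] at hsq'
        have hpos : 0 ≤ ((m + 1 : ℕ) : ℝ) ^ (2 * ε) := by positivity
        rw [div_le_div_iff₀ two_pos (by positivity)]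
        push_cast at hsq' hpos ⊢
        linarith
      have hp := (choose_div_le_exp hm i).trans (hexp.trans (hK _ hx1))
      have hp0 : 0 ≤ (m.choose i : ℝ) / 2 ^ m := by positivity
      linarith
  · have hmid : (m : ℝ) - 2 * (m / 2 : ℕ) ≤ ((m + 1 : ℕ) : ℝ) ^ (1 / 2 + ε) := by
      refine le_trans ?_ hT1
      have : m ≤ 2 * (m / 2) + 1 := by omega
      have : (m : ℝ) ≤ 2 * (m / 2 : ℕ) + 1 := by exact_mod_cast this
      linarith
    have h1 := choose_div_le_of_near_middle hε hε' (by omega) hmid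
    have h2 : (m.choose i : ℝ) / 2 ^ m ≤ (m.choose (m / 2) : ℝ) / 2 ^ m := by
      gcongr
      exact Nat.choose_le_middle i m
    have h3 := mul_le_mul_of_nonneg_left
      (binomCdf_mono m (show m / 2 ≤ i by omega)) hB0
    linarith

/-- For every ε > 0 there exists a finite constant C such that for all integers
h ≥ 1 and k ≥ 0, if the chain Z starts at k then
P(τ̃_h < ∞ and Z̃_{τ̃_h} = h) < C·h^{−1/2+ε}. -/
theorem stmt_8 :
    ∀ ε : ℝ, 0 < ε → ∃ C : ℝ,
      ∀ (h k : ℕ), 1 ≤ h →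
        ∀ (Ω : Type) (_ : MeasurableSpace Ω) (P : Measure Ω) (Z : ℕ → Ω → ℕ),
          IsProbabilityMeasure P → IsMarkovChainFrom P Z rho k →
          P {ω | ∃ t : ℕ, tauTil Z h ω = (t : ℕ∞) ∧ Ztil Z t ω = h} <
            ENNReal.ofReal (C * (h : ℝ) ^ (-(1 : ℝ) / 2 + ε)) := by
  intro ε hε
  obtain ⟨K, hK0, hK⟩ := exists_rho_le (ε := min ε (1 / 4)) (by positivity) (min_le_right _ _)
  refine ⟨16 + K + 1, fun h k hh Ω _ P Z _ hZ => ?_⟩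
  have hh1 : (1 : ℝ) ≤ h := by exact_mod_cast hh
  have hh0 : (0 : ℝ) < h := by linarith
  set B : ℝ := (h : ℝ) ^ (-(1 : ℝ) / 2 + min ε (1 / 4))
  have hB0 : 0 < B := by positivity
  have hB : B ≤ (h : ℝ) ^ (-(1 : ℝ) / 2 + ε) :=
    Real.rpow_le_rpow_of_exponent_le hh1 (by linarith [min_le_left ε (1 / 4)])
  have hE : 0 ≤ K / (h : ℝ) ^ 2 := by positivity
  have hinv : (h : ℝ)⁻¹ ≤ B := by
    rw [← Real.rpow_neg_one]
    refine Real.rpow_le_rpow_of_exponent_le hh1 ?_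
    have : 0 < min ε (1 / 4) := by positivity
    linarith
  set f : ℕ → ℝ := fun i => 16 * B + K / (h : ℝ) ^ 2 * ((h - i : ℕ) : ℝ)
  have hf0 (i : ℕ) : 0 ≤ f i := by positivity
  have hhit := hZ.measure_hit_le rho_nonneg (h := h) (F := fun i => ENNReal.ofReal (f i)) (by
    intro i n hin
    simp_rw [← ENNReal.ofReal_mul (rho_nonneg _ _)]
    rw [← ENNReal.ofReal_sum_of_nonneg fun j _ => mul_nonneg (rho_nonneg _ _) (hf0 j),
      ← ENNReal.ofReal_add (rho_nonneg _ _)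
        (Finset.sum_nonneg fun j _ => mul_nonneg (rho_nonneg _ _) (hf0 j))]
    refine ENNReal.ofReal_le_ofReal ?_
    convert rho_add_sum_le hE i n (hK h i n hin) using 2
    · refine Finset.sum_congr rfl fun j hj => ?_
      have hj := Finset.mem_range.1 hj
      simp only [f]
      have hcast : (h : ℝ) = i + n + 1 := by
        rw [← hin]
        push_cast
        rfl
      rw [Nat.cast_sub (by omega), ← hcast]
    · rw [show h - i = n + 1 by omega]
      push_cast
      rfl)
  refine hhit.trans_lt ((ENNReal.ofReal_lt_ofReal_iff (by positivity)).2 ?_)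
  have hfk : f k ≤ 16 * B + K * (h : ℝ)⁻¹ := by
    have h1 : ((h - k : ℕ) : ℝ) ≤ h := by exact_mod_cast Nat.sub_le h k
    have h2 : K / (h : ℝ) ^ 2 * h = K * (h : ℝ)⁻¹ := by field_simp
    have h3 := mul_le_mul_of_nonneg_left h1 hE
    simp only [f]
    linarith
  calc f k ≤ 16 * B + K * B := hfk.trans (by gcongr)
    _ < (16 + K + 1) * B := by linarith
    _ ≤ _ := by gcongr
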